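/- Let Z be a standard normal random variable, let μ ∈ ℝ, σ > 0, and w ≥ 0. Define the standardized thresholds ẑ := (−w − μ)/σ, z₀ := −μ/σ, and z̄ := (w − μ)/σ. Then E[max(0, w − |μ + σZ|)] = w·(Φ(z̄) − Φ(ẑ)) + μ·(2Φ(z₀) − Φ(z̄) − Φ(ẑ)) − σ·(2φ(z₀) − φ(z̄) − φ(ẑ)), where Φ and φ are the standard normal cumulative distribution function and density. -/

import Mathlib

open MeasureTheory ProbabilityTheory

/-- The standard normal density `φ(b) = (2π)^{-1/2} e^{-b²/2}`. -/
noncomputable def stdGaussianPDF (b : ℝ) : ℝ :=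
  (Real.sqrt (2 * Real.pi))⁻¹ * Real.exp (-(b ^ 2) / 2)

/-- The standard normal cumulative distribution function `Φ(a) = ∫_{-∞}^a φ`. -/
noncomputable def stdGaussianCDF (a : ℝ) : ℝ :=
  ∫ b in Set.Iic a, stdGaussianPDF b

lemma continuous_stdGaussianPDF : Continuous stdGaussianPDF := by
  unfold stdGaussianPDF
  fun_prop

lemma stdGaussianPDF_eq_gaussianPDFReal : stdGaussianPDF = gaussianPDFReal 0 1 := by
  ext b
  simp [stdGaussianPDF, gaussianPDFReal]

lemma integrable_stdGaussianPDF : Integrable stdGaussianPDF := by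
  rw [stdGaussianPDF_eq_gaussianPDFReal]
  exact integrable_gaussianPDFReal 0 1

lemma hasDerivAt_stdGaussianPDF (x : ℝ) :
    HasDerivAt stdGaussianPDF (-(x * stdGaussianPDF x)) x := by
  have h : HasDerivAt (fun b : ℝ => -(b ^ 2) / 2) (-x) x := by
    refine ((hasDerivAt_pow 2 x).fun_neg.div_const 2).congr_deriv ?_
    norm_num
    ring
  refine (h.exp.const_mul (Real.sqrt (2 * Real.pi))⁻¹).congr_deriv ?_
  rw [stdGaussianPDF]
  ring

lemma intervalIntegral_stdGaussianPDF (a b : ℝ) :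
    ∫ x in a..b, stdGaussianPDF x = stdGaussianCDF b - stdGaussianCDF a :=
  (intervalIntegral.integral_Iic_sub_Iic integrable_stdGaussianPDF.integrableOn
    integrable_stdGaussianPDF.integrableOn).symm

lemma intervalIntegral_id_mul_stdGaussianPDF (a b : ℝ) :
    ∫ x in a..b, x * stdGaussianPDF x = stdGaussianPDF a - stdGaussianPDF b := by
  have h := intervalIntegral.integral_eq_sub_of_hasDerivAt
    (fun x _ => hasDerivAt_stdGaussianPDF x)
    ((continuous_id.mul continuous_stdGaussianPDF).neg.intervalIntegrable a b)
  rw [intervalIntegral.integral_neg] at h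
  linarith

/-- The integral of an affine function against the standard normal density. -/
lemma intervalIntegral_stdGaussianPDF_mul_affine (a b c d : ℝ) :
    ∫ x in a..b, stdGaussianPDF x * (c + d * x)
      = c * (stdGaussianCDF b - stdGaussianCDF a)
        + d * (stdGaussianPDF a - stdGaussianPDF b) := by
  have hcont : Continuous fun x => x * stdGaussianPDF x :=
    continuous_id.mul continuous_stdGaussianPDF
  rw [← intervalIntegral_stdGaussianPDF, ← intervalIntegral_id_mul_stdGaussianPDF,
    ← intervalIntegral.integral_const_mul, ← intervalIntegral.integral_const_mul,
    ← intervalIntegral.integral_add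
      ((continuous_stdGaussianPDF.const_mul c).intervalIntegrable a b)
      ((hcont.const_mul d).intervalIntegrable a b)]
  congr 1
  ext x
  ring

/-- closed form of the root-finding Expected Improvement:
for `Z` standard normal, `σ > 0`, `w ≥ 0`, with `ẑ = (−w−μ)/σ`, `z₀ = −μ/σ`,
`z̄ = (w−μ)/σ`,
`E[max(0, w − |μ + σZ|)] = w(Φ(z̄) − Φ(ẑ)) + μ(2Φ(z₀) − Φ(z̄) − Φ(ẑ))
  − σ(2φ(z₀) − φ(z̄) − φ(ẑ))`. -/
theorem root_finding_expected_improvement_closed_form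
    {Ω : Type*} [MeasureSpace Ω] [IsProbabilityMeasure (volume : Measure Ω)]
    (Z : Ω → ℝ) (hZ : Measure.map Z volume = gaussianReal 0 1)
    (μ σ w : ℝ) (hσ : 0 < σ) (hw : 0 ≤ w)
    (zlo z0 zhi : ℝ)
    (hzlo : zlo = (-w - μ) / σ) (hz0 : z0 = -μ / σ) (hzhi : zhi = (w - μ) / σ) :
    (∫ ω, max 0 (w - |μ + σ * Z ω|))
      = w * (stdGaussianCDF zhi - stdGaussianCDF zlo)
        + μ * (2 * stdGaussianCDF z0 - stdGaussianCDF zhi - stdGaussianCDF zlo)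
        - σ * (2 * stdGaussianPDF z0 - stdGaussianPDF zhi - stdGaussianPDF zlo) := by
  have hZm : AEMeasurable Z volume := by
    refine AEMeasurable.of_map_ne_zero ?_
    rw [hZ]
    exact IsProbabilityMeasure.ne_zero _
  have hlaw : (∫ ω, max 0 (w - |μ + σ * Z ω|))
      = ∫ x, stdGaussianPDF x * max 0 (w - |μ + σ * x|) := by
    rw [← integral_map (f := fun x : ℝ => max 0 (w - |μ + σ * x|)) hZm
      (by fun_prop), hZ, integral_gaussianReal_eq_integral_smul one_ne_zero,
      stdGaussianPDF_eq_gaussianPDFReal]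
    simp only [smul_eq_mul]
  have hlo : σ * zlo = -w - μ := by rw [hzlo]; field_simp
  have hmid : σ * z0 = -μ := by rw [hz0]; field_simp
  have hhi : σ * zhi = w - μ := by rw [hzhi]; field_simp
  have hlomid : zlo ≤ z0 := le_of_mul_le_mul_left (by linarith) hσ
  have hmidhi : z0 ≤ zhi := le_of_mul_le_mul_left (by linarith) hσ
  have hsupp : Function.support (fun x => stdGaussianPDF x * max 0 (w - |μ + σ * x|))
      ⊆ Set.Ioc zlo zhi := by
    intro x hx
    have hne : max 0 (w - |μ + σ * x|) ≠ 0 := right_ne_zero_of_mul hx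
    have hlt : |μ + σ * x| < w := by
      by_contra! h
      exact hne (max_eq_left (by linarith))
    obtain ⟨h1, h2⟩ := abs_lt.mp hlt
    exact ⟨lt_of_mul_lt_mul_left (by linarith) hσ.le,
      le_of_mul_le_mul_left (by linarith) hσ⟩
  have hcont : Continuous fun x => stdGaussianPDF x * max 0 (w - |μ + σ * x|) :=
    continuous_stdGaussianPDF.mul (by fun_prop)
  have hleft : ∫ x in zlo..z0, stdGaussianPDF x * max 0 (w - |μ + σ * x|)
      = ∫ x in zlo..z0, stdGaussianPDF x * ((w + μ) + σ * x) := by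
    refine intervalIntegral.integral_congr fun x hx => ?_
    rw [Set.uIcc_of_le hlomid] at hx
    have h1 := mul_le_mul_of_nonneg_left hx.1 hσ.le
    have h2 := mul_le_mul_of_nonneg_left hx.2 hσ.le
    rw [abs_of_nonpos (by linarith), max_eq_right (by linarith)]
    ring
  have hright : ∫ x in z0..zhi, stdGaussianPDF x * max 0 (w - |μ + σ * x|)
      = ∫ x in z0..zhi, stdGaussianPDF x * ((w - μ) + (-σ) * x) := by
    refine intervalIntegral.integral_congr fun x hx => ?_
    rw [Set.uIcc_of_le hmidhi] at hx
    have h1 := mul_le_mul_of_nonneg_left hx.1 hσ.le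
    have h2 := mul_le_mul_of_nonneg_left hx.2 hσ.le
    rw [abs_of_nonneg (by linarith), max_eq_right (by linarith)]
    ring
  rw [hlaw, ← intervalIntegral.integral_eq_integral_of_support_subset hsupp,
    ← intervalIntegral.integral_add_adjacent_intervals
      (hcont.intervalIntegrable zlo z0) (hcont.intervalIntegrable z0 zhi),
    hleft, hright, intervalIntegral_stdGaussianPDF_mul_affine,
    intervalIntegral_stdGaussianPDF_mul_affine]
  ring
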